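/- arXiv:1909.07023 — 4 statements merged into one kernel-verified Lean document; each statement's English description precedes it below -/
import Mathlib

section
/- Let V be a finite set and let d, e : (V → ℕ) → ℕ be functions. For s : V → ℕ and v ∈ V write s^v for the function obtained from s by increasing the value at v by 1, and for s ≤ s̃ (pointwise) write |s̃ − s| := Σ_{v∈V} (s̃(v) − s(v)). Assume: (i) for every s and every v, d(s^v) ≤ d(s) ≤ d(s^v) + 1; (ii) d(s) ≤ e(s) for every s; (iii) for every s, if d(s) = d(s^v) for all v ∈ V, then d(s) = e(s). Then for every s : V → ℕ one has d(s) = min{ |s̃ − s| + e(s̃) : s̃ : V → ℕ, s̃ ≥ s pointwise }, and this minimum (an infimum of a nonempty set of natural numbers) is attained. -/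
theorem update_succ_le {V : Type*} [DecidableEq V] {s s' : V → ℕ} {v : V}
    (hs : s ≤ s') (hv : s v < s' v) : Function.update s v (s v + 1) ≤ s' :=
  update_le_iff.mpr ⟨hv, fun w _ => hs w⟩

theorem le_update_succ {V : Type*} [DecidableEq V] (s : V → ℕ) (v : V) :
    s ≤ Function.update s v (s v + 1) :=
  le_update_iff.mpr ⟨Nat.le_succ _, fun _ _ => le_rfl⟩

theorem sum_sub_eq_sum_sub_update_succ {V : Type*} [Fintype V] [DecidableEq V]
    {s s' : V → ℕ} {v : V} (hv : s v < s' v) :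
    ∑ w, (s' w - s w) = ∑ w, (s' w - Function.update s v (s v + 1) w) + 1 := by
  rw [Fintype.sum_eq_add_sum_compl v, Fintype.sum_eq_add_sum_compl v]
  have h : ∑ w ∈ {v}ᶜ, (s' w - Function.update s v (s v + 1) w) = ∑ w ∈ {v}ᶜ, (s' w - s w) := by
    refine Finset.sum_congr rfl fun w hw => ?_
    rw [Function.update_of_ne (by simpa using hw)]
  rw [h, Function.update_self]
  omega

/-- A function dropping by at most one under each unit increment is Lipschitz from above. -/
theorem le_sum_sub_add_of_le_update_succ {V : Type*} [Fintype V] [DecidableEq V]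
    {d : (V → ℕ) → ℕ} (h : ∀ s v, d s ≤ d (Function.update s v (s v + 1)) + 1)
    {s s' : V → ℕ} (hs : s ≤ s') : d s ≤ ∑ v, (s' v - s v) + d s' := by
  induction hn : ∑ v, (s' v - s v) generalizing s with
  | zero =>
    have hss : s = s' := le_antisymm hs fun v =>
      Nat.sub_eq_zero_iff_le.mp (Finset.sum_eq_zero_iff.mp hn v (Finset.mem_univ v))
    simp [hss]
  | succ n ih =>
    obtain ⟨v, -, hv⟩ := Finset.exists_ne_zero_of_sum_ne_zero (hn.trans_ne n.succ_ne_zero)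
    have hlt : s v < s' v := by omega
    have hsum := sum_sub_eq_sum_sub_update_succ hlt
    have hle := ih (update_succ_le hs hlt) (by omega)
    have hstep := h s v
    omega

theorem exists_le_eq_sum_sub_add {V : Type*} [Fintype V] [DecidableEq V]
    {d e : (V → ℕ) → ℕ}
    (h1 : ∀ s v, d (Function.update s v (s v + 1)) ≤ d s ∧
      d s ≤ d (Function.update s v (s v + 1)) + 1)
    (h3 : ∀ s, (∀ v, d s = d (Function.update s v (s v + 1))) → d s = e s) (s : V → ℕ) :
    ∃ s', s ≤ s' ∧ d s = ∑ v, (s' v - s v) + e s' := by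
  induction hn : d s using Nat.strong_induction_on generalizing s with
  | _ n ih =>
    by_cases hs : ∀ v, d s = d (Function.update s v (s v + 1))
    · exact ⟨s, le_rfl, by simp [← hn, h3 s hs]⟩
    · push Not at hs
      obtain ⟨v, hv⟩ := hs
      have hstep := h1 s v
      obtain ⟨s', hle, heq⟩ := ih _ (by omega) (Function.update s v (s v + 1)) rfl
      have hlt : s v < s' v := by simpa [Nat.succ_le_iff] using hle v
      have hsum := sum_sub_eq_sum_sub_update_succ hlt
      exact ⟨s', (le_update_succ s v).trans hle, by omega⟩

/-- combinatorial core of the Pattern Theorem.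
Let `V` be a finite set, `d e : (V → ℕ) → ℕ`.  For `s : V → ℕ` and `v ∈ V`,
`s^v := Function.update s v (s v + 1)`.  Assume:
(i)  `d(s^v) ≤ d(s) ≤ d(s^v) + 1` for all `s, v`;
(ii) `d(s) ≤ e(s)` for all `s`;
(iii) if `d(s) = d(s^v)` for all `v`, then `d(s) = e(s)`.
Then for every `s`, `d(s)` is the least element (so the minimum is attained) of
`{ |s̃ − s| + e(s̃) : s̃ ≥ s }`, where `|s̃ − s| = Σ_v (s̃(v) − s(v))`. -/
theorem stmt_0 (V : Type) [Fintype V] [DecidableEq V]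
    (d e : (V → ℕ) → ℕ)
    (h1 : ∀ (s : V → ℕ) (v : V),
      d (Function.update s v (s v + 1)) ≤ d s ∧
      d s ≤ d (Function.update s v (s v + 1)) + 1)
    (h2 : ∀ s : V → ℕ, d s ≤ e s)
    (h3 : ∀ s : V → ℕ,
      (∀ v : V, d s = d (Function.update s v (s v + 1))) → d s = e s) :
    ∀ s : V → ℕ,
      IsLeast {n : ℕ | ∃ s' : V → ℕ, s ≤ s' ∧ n = (∑ v, (s' v - s v)) + e s'}
        (d s) := by
  intro s
  refine ⟨exists_le_eq_sum_sub_add h1 h3 s, ?_⟩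
  rintro n ⟨s', hs, rfl⟩
  exact (le_sum_sub_add_of_le_update_succ (fun s v => (h1 s v).2) hs).trans
    (Nat.add_le_add_left (h2 s') _)
end

section
/- For all natural numbers d ≥ 2 and k ≥ 1: min_{0 ≤ s ≤ d−2} ( k·s + C(d−s, 3) ) = Σ_{j=0}^{d−3} min( k, C(j+2, 2) ), where C(n,m) denotes the binomial coefficient (with C(n,m) = 0 for n < m) and the sum on the right is empty (equal to 0) when d = 2. -/
theorem sum_range_add_two_choose_two (n : ℕ) :
    ∑ j ∈ Finset.range n, (j + 2).choose 2 = (n + 2).choose 3 := by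
  induction n with
  | zero => rfl
  | succ n ih => rw [Finset.sum_range_succ, ih, Nat.choose_succ_succ' (n + 2) 2, add_comm]

theorem sum_range_min_le (a : ℕ → ℕ) (k m s : ℕ) :
    ∑ j ∈ Finset.range (m + s), min k (a j) ≤ k * s + ∑ j ∈ Finset.range m, a j := by
  induction s with
  | zero => simpa using Finset.sum_le_sum fun j _ => min_le_right k (a j)
  | succ s ih =>
    rw [← add_assoc, Finset.sum_range_succ, Nat.mul_succ]
    have := min_le_left k (a (m + s))
    omega

theorem exists_sum_range_min_eq {a : ℕ → ℕ} (ha : Monotone a) (k n : ℕ) :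
    ∃ m s, m + s = n ∧
      ∑ j ∈ Finset.range n, min k (a j) = k * s + ∑ j ∈ Finset.range m, a j := by
  induction n with
  | zero => exact ⟨0, 0, by simp⟩
  | succ n ih =>
    rcases le_total (a n) k with h | h
    · refine ⟨n + 1, 0, rfl, ?_⟩
      rw [mul_zero, zero_add]
      refine Finset.sum_congr rfl fun j hj => min_eq_right ((ha ?_).trans h)
      exact Finset.mem_range_succ_iff.mp hj
    · obtain ⟨m, s, rfl, hs⟩ := ih
      refine ⟨m, s + 1, rfl, ?_⟩
      rw [Finset.sum_range_succ, hs, min_eq_left h, Nat.mul_succ]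
      omega

/-- For natural numbers `d ≥ 2`, `k ≥ 1`:
`min_{0 ≤ s ≤ d−2} (k·s + C(d−s,3)) = Σ_{j=0}^{d−3} min(k, C(j+2,2))`,
where the sum is empty (= 0) when `d = 2`. -/
theorem stmt_2 (d k : ℕ) (hd : 2 ≤ d) (hk : 1 ≤ k) :
    (Finset.range (d - 1)).inf'
        (Finset.nonempty_range_iff.mpr (by omega))
        (fun s => k * s + Nat.choose (d - s) 3)
      = ∑ j ∈ Finset.range (d - 2), min k (Nat.choose (j + 2) 2) := by
  obtain ⟨n, rfl⟩ := Nat.exists_eq_add_of_le' hd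
  rw [Nat.add_sub_cancel]
  apply le_antisymm
  · have hmono : Monotone fun j : ℕ => (j + 2).choose 2 := fun i j hij =>
      Nat.choose_le_choose 2 (Nat.add_le_add_right hij 2)
    obtain ⟨m, s, rfl, hs⟩ := exists_sum_range_min_eq hmono k n
    rw [hs, sum_range_add_two_choose_two]
    refine (Finset.inf'_le _ (Finset.mem_range.mpr (by omega : s < m + s + 2 - 1))).trans_eq ?_
    rw [show m + s + 2 - s = m + 2 by omega]
  · refine Finset.le_inf' _ _ fun s hs => ?_
    obtain ⟨m, rfl⟩ := Nat.exists_eq_add_of_le' (show s ≤ n by have := Finset.mem_range.mp hs; omega)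
    rw [show m + s + 2 - s = m + 2 by omega, ← sum_range_add_two_choose_two]
    exact sum_range_min_le _ k m s
end

section
/- Let V be a nonempty finite set and let (·,·) be a negative definite symmetric ℤ-valued bilinear form on L := ℤ^V with standard basis {E_v}_{v∈V}, satisfying (E_u,E_v) ≥ 0 for u ≠ v; let the dual graph G (edge between u ≠ v iff (E_u,E_v) > 0) be connected; let Z_K ∈ ℚ^V be the unique vector with (Z_K,E_v) = (E_v,E_v)+2 for all v, and χ(x) := −(x, x−Z_K)/2. Fix l' with (l',E_v) a nonnegative integer for every v (i.e. l' ∈ −S'), fix a cycle Z ∈ L with all coordinates ≥ 1, and assume there exists l with 0 < l ≤ Z and χ(−l'+l) ≤ χ(−l'). Let Z' be a ≤-minimal element of the set of cycles 0 < Z' ≤ Z realizing the maximum t(Z,l') = max_{0<Z''≤Z} Σ_i T(Z''_i,l'). Then D(Z'_i, l') = 1 for every connected component Z'_i of Z'. -/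
open Classical

noncomputable section

/-- The rational pairing on `ℚ^V` determined by the integral matrix `M`. -/
def pairQ {V : Type} [Fintype V] (M : Matrix V V ℤ) (x y : V → ℚ) : ℚ :=
  ∑ u, ∑ v, x u * (M u v : ℚ) * y v

/-- The Riemann–Roch expression `χ(x) = −(x, x − Z_K)/2`. -/
def chiQ {V : Type} [Fintype V] (M : Matrix V V ℤ) (ZK : V → ℚ) (x : V → ℚ) : ℚ :=
  - pairQ M x (x - ZK) / 2

/-- Inclusion of integral cycles into `ℚ^V`. -/
def toQ {V : Type} (l : V → ℤ) : V → ℚ := fun v => (l v : ℚ)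

/-- The dual graph: `u ~ v` iff `u ≠ v` and `M u v > 0` (for symmetric `M`). -/
def dualGraph {V : Type} (M : Matrix V V ℤ) : SimpleGraph V :=
  SimpleGraph.fromRel (fun u v => 0 < M u v)

/-- The support `|Z|` of a cycle. -/
def supp {V : Type} (Z : V → ℤ) : Set V := {v | Z v ≠ 0}

/-- The dual graph induced on the support of a cycle. -/
def inducedOnSupp {V : Type} (M : Matrix V V ℤ) (Z : V → ℤ) :
    SimpleGraph (supp Z) :=
  (dualGraph M).induce (supp Z)

/-- The part `Z_c` of a cycle `Z` corresponding to a connected component `c`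
of the dual graph induced on the support of `Z`:  it agrees with `Z` on the
component and vanishes elsewhere. -/
def compCycle {V : Type} (M : Matrix V V ℤ) (Z : V → ℤ)
    (c : (inducedOnSupp M Z).ConnectedComponent) : V → ℤ := fun v =>
  if h : Z v ≠ 0 then
    (if (inducedOnSupp M Z).connectedComponentMk ⟨v, h⟩ = c then Z v else 0)
  else 0

/-- The sum `Σ_i F(Z_i)` of a quantity `F` over the connected components
`Z = Σ_i Z_i` of a cycle. -/
def sumComp {V : Type} [Fintype V] (M : Matrix V V ℤ)
    (F : (V → ℤ) → ℚ) (Z : V → ℤ) : ℚ :=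
  ∑ᶠ c : (inducedOnSupp M Z).ConnectedComponent, F (compCycle M Z c)

end

section Components

variable {V : Type} (M : Matrix V V ℤ) (Z : V → ℤ)

lemma compCycle_of_mk_eq {c : (inducedOnSupp M Z).ConnectedComponent} {v : V} (h : v ∈ supp Z)
    (hc : (inducedOnSupp M Z).connectedComponentMk ⟨v, h⟩ = c) : compCycle M Z c v = Z v := by
  have h' : Z v ≠ 0 := h
  simp only [compCycle, dif_pos h', if_pos hc]

lemma compCycle_of_mk_ne {c : (inducedOnSupp M Z).ConnectedComponent} {v : V} (h : v ∈ supp Z)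
    (hc : (inducedOnSupp M Z).connectedComponentMk ⟨v, h⟩ ≠ c) : compCycle M Z c v = 0 := by
  have h' : Z v ≠ 0 := h
  simp only [compCycle, dif_pos h', if_neg hc]

lemma compCycle_of_eq_zero (c : (inducedOnSupp M Z).ConnectedComponent) {v : V} (h : Z v = 0) :
    compCycle M Z c v = 0 := by
  simp [compCycle, h]

lemma compCycle_eq_zero_or_eq (c : (inducedOnSupp M Z).ConnectedComponent) (v : V) :
    compCycle M Z c v = 0 ∨ compCycle M Z c v = Z v := by
  by_cases h : Z v = 0
  · exact Or.inl (compCycle_of_eq_zero M Z c h)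
  · by_cases hc : (inducedOnSupp M Z).connectedComponentMk ⟨v, h⟩ = c
    · exact Or.inr (compCycle_of_mk_eq M Z h hc)
    · exact Or.inl (compCycle_of_mk_ne M Z h hc)

lemma compCycle_nonneg {Z : V → ℤ} (hZ : 0 ≤ Z) (c : (inducedOnSupp M Z).ConnectedComponent) :
    0 ≤ compCycle M Z c := fun v => by
  have h : (0 : ℤ) ≤ Z v := hZ v
  change (0 : ℤ) ≤ _
  rcases compCycle_eq_zero_or_eq M Z c v with h' | h' <;> omega

lemma compCycle_le {Z : V → ℤ} (hZ : 0 ≤ Z) (c : (inducedOnSupp M Z).ConnectedComponent) :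
    compCycle M Z c ≤ Z := fun v => by
  have h : (0 : ℤ) ≤ Z v := hZ v
  change compCycle M Z c v ≤ Z v
  rcases compCycle_eq_zero_or_eq M Z c v with h' | h' <;> omega

lemma compCycle_ne_zero (c : (inducedOnSupp M Z).ConnectedComponent) : compCycle M Z c ≠ 0 := by
  induction c using SimpleGraph.ConnectedComponent.ind with
  | h v =>
    intro h
    exact v.2 ((compCycle_of_mk_eq M Z v.2 rfl).symm.trans (congrFun h v))

/-- The cycle obtained from `Z` by removing the component `c`. -/
noncomputable def removeComp (c : (inducedOnSupp M Z).ConnectedComponent) : V → ℤ := Z - compCycle M Z c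

variable {M Z} {c : (inducedOnSupp M Z).ConnectedComponent}

lemma mem_supp_removeComp {v : V} :
    v ∈ supp (removeComp M Z c) ↔
      ∃ h : v ∈ supp Z, (inducedOnSupp M Z).connectedComponentMk ⟨v, h⟩ ≠ c := by
  by_cases h : v ∈ supp Z
  · rw [exists_prop_of_true h]
    by_cases hc : (inducedOnSupp M Z).connectedComponentMk ⟨v, h⟩ = c
    · refine iff_of_false (fun hv => hv ?_) (not_not.2 hc)
      simp [removeComp, compCycle_of_mk_eq M Z h hc]
    · refine iff_of_true (fun hv => h ?_) hc
      simpa [removeComp, compCycle_of_mk_ne M Z h hc] using hv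
  · have h' : Z v = 0 := by simpa [supp] using h
    simp [supp, removeComp, compCycle_of_eq_zero M Z c h', h']

lemma removeComp_apply {v : V} (h : v ∈ supp (removeComp M Z c)) :
    removeComp M Z c v = Z v := by
  obtain ⟨hZ, hc⟩ := mem_supp_removeComp.1 h
  simp [removeComp, compCycle_of_mk_ne M Z hZ hc]

variable (M Z c) in
/-- The inclusion of the graph on the support of `removeComp M Z c`. -/
def removeCompHom : inducedOnSupp M (removeComp M Z c) →g inducedOnSupp M Z where
  toFun v := ⟨v, (mem_supp_removeComp.1 v.2).1⟩
  map_rel' h := h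

lemma reachable_removeComp {a b : supp Z} (h : (inducedOnSupp M Z).Reachable a b)
    (ha : (a : V) ∈ supp (removeComp M Z c)) (hb : (b : V) ∈ supp (removeComp M Z c)) :
    (inducedOnSupp M (removeComp M Z c)).Reachable ⟨a, ha⟩ ⟨b, hb⟩ := by
  obtain ⟨p⟩ := h
  induction p with
  | nil => rfl
  | @cons u v w huv p ih =>
    have hv : (v : V) ∈ supp (removeComp M Z c) := by
      refine mem_supp_removeComp.2 ⟨v.2, ?_⟩
      obtain ⟨_, hne⟩ := mem_supp_removeComp.1 ha
      rwa [← SimpleGraph.ConnectedComponent.connectedComponentMk_eq_of_adj huv]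
    have hadj : (inducedOnSupp M (removeComp M Z c)).Adj ⟨u, ha⟩ ⟨v, hv⟩ := huv
    exact hadj.reachable.trans (ih hv hb)

lemma map_removeCompHom_injective :
    Function.Injective (SimpleGraph.ConnectedComponent.map (removeCompHom M Z c)) := by
  intro a b
  induction a using SimpleGraph.ConnectedComponent.ind with
  | h v =>
  induction b using SimpleGraph.ConnectedComponent.ind with
  | h w =>
    intro h
    rw [SimpleGraph.ConnectedComponent.map_mk, SimpleGraph.ConnectedComponent.map_mk,
      SimpleGraph.ConnectedComponent.eq] at h
    exact SimpleGraph.ConnectedComponent.eq.2 (reachable_removeComp h v.2 w.2)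

lemma range_map_removeCompHom :
    Set.range (SimpleGraph.ConnectedComponent.map (removeCompHom M Z c)) = {c}ᶜ := by
  ext d
  constructor
  · rintro ⟨a, rfl⟩
    induction a using SimpleGraph.ConnectedComponent.ind with
    | h v => exact (mem_supp_removeComp.1 v.2).2
  · induction d using SimpleGraph.ConnectedComponent.ind with
    | h v =>
      intro hv
      exact ⟨SimpleGraph.connectedComponentMk _ ⟨v, mem_supp_removeComp.2 ⟨v.2, hv⟩⟩, rfl⟩

lemma compCycle_removeComp (d : (inducedOnSupp M (removeComp M Z c)).ConnectedComponent) :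
    compCycle M (removeComp M Z c) d = compCycle M Z (d.map (removeCompHom M Z c)) := by
  funext v
  by_cases hv : v ∈ supp (removeComp M Z c)
  · have hvZ := (mem_supp_removeComp.1 hv).1
    by_cases hd : (inducedOnSupp M (removeComp M Z c)).connectedComponentMk ⟨v, hv⟩ = d
    · rw [compCycle_of_mk_eq M _ hv hd, removeComp_apply hv, compCycle_of_mk_eq M Z hvZ]
      rw [← hd]
      rfl
    · rw [compCycle_of_mk_ne M _ hv hd, compCycle_of_mk_ne M Z hvZ]
      exact fun h => hd (map_removeCompHom_injective h)
  · have hv0 : removeComp M Z c v = 0 := by simpa [supp] using hv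
    rw [compCycle_of_eq_zero M _ d hv0]
    by_cases hZ : v ∈ supp Z
    · refine (compCycle_of_mk_ne M Z hZ fun h => hv ?_).symm
      refine mem_supp_removeComp.2 ⟨hZ, ?_⟩
      rw [h]
      have := Set.mem_range_self (f := SimpleGraph.ConnectedComponent.map (removeCompHom M Z c)) d
      rwa [range_map_removeCompHom] at this
    · exact (compCycle_of_eq_zero M Z _ (by simpa [supp] using hZ)).symm

lemma sumComp_removeComp [Fintype V] (F : (V → ℤ) → ℚ) (hF : F (compCycle M Z c) = 0) :
    sumComp M F (removeComp M Z c) = sumComp M F Z := by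
  unfold sumComp
  simp_rw [compCycle_removeComp]
  rw [← finsum_mem_range (f := fun d => F (compCycle M Z d)) map_removeCompHom_injective,
    range_map_removeCompHom, finsum_mem_def]
  refine finsum_congr fun d => ?_
  by_cases hd : d = c
  · simp [hd, hF]
  · simp [hd]

lemma sumComp_zero [Fintype V] (F : (V → ℤ) → ℚ) : sumComp M F 0 = 0 := by
  have : IsEmpty (supp (0 : V → ℤ)) := ⟨fun v => v.2 rfl⟩
  have : IsEmpty (inducedOnSupp M (0 : V → ℤ)).ConnectedComponent :=
    ⟨fun d => d.ind fun v => isEmptyElim v⟩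
  exact finsum_of_isEmpty _

lemma sumComp_of_connected [Fintype V] (F : (V → ℤ) → ℚ) (hconn : (dualGraph M).Connected)
    (hZ : ∀ v, Z v ≠ 0) : sumComp M F Z = F Z := by
  let e : dualGraph M →g inducedOnSupp M Z := ⟨fun v => ⟨v, hZ v⟩, fun h => h⟩
  have hmk (a b : supp Z) : (inducedOnSupp M Z).connectedComponentMk a =
      (inducedOnSupp M Z).connectedComponentMk b :=
    SimpleGraph.ConnectedComponent.eq.2 ((hconn.preconnected a b).map e)
  have hsub : Subsingleton (inducedOnSupp M Z).ConnectedComponent :=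
    ⟨fun a b => SimpleGraph.ConnectedComponent.ind₂ hmk a b⟩
  obtain ⟨v⟩ := hconn.nonempty
  let d := (inducedOnSupp M Z).connectedComponentMk ⟨v, hZ v⟩
  have hd : compCycle M Z d = Z :=
    funext fun w => compCycle_of_mk_eq M Z (hZ w) (Subsingleton.elim _ _)
  rw [sumComp, finsum_eq_single _ d fun x hx => (hx (Subsingleton.elim _ _)).elim, hd]

end Components

/-- Lemma 6.4(a).  Under the combinatorial setup of a
negative definite connected resolution lattice, if the Abel map is not
dominant (some `0 < l ≤ Z` has `χ(−l'+l) ≤ χ(−l')`) and `Z'` is a `≤`-minimal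
cycle `0 < Z' ≤ Z` realizing the maximum
`t(Z,l') = max_{0<Z''≤Z} Σ_i T(Z''_i,l')`, then `D(Z'_i,l') = 1` for every
connected component `Z'_i` of `Z'`. -/
theorem stmt_3
    (V : Type) [Fintype V] [DecidableEq V] [Nonempty V]
    (M : Matrix V V ℤ)
    (hsym : ∀ u v, M u v = M v u)
    (hneg : ∀ x : V → ℚ, x ≠ 0 → pairQ M x x < 0)
    (hoff : ∀ u v : V, u ≠ v → 0 ≤ M u v)
    (hconn : (dualGraph M).Connected)
    (ZK : V → ℚ)
    (hZK : ∀ v, pairQ M ZK (Pi.single v 1) = (M v v : ℚ) + 2)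
    (l' : V → ℚ)
    (hl' : ∀ v, ∃ n : ℕ, pairQ M l' (Pi.single v 1) = n)
    (Z : V → ℤ) (hZ : ∀ v, 1 ≤ Z v)
    (hnotdom : ∃ l : V → ℤ, 0 < l ∧ l ≤ Z ∧
      chiQ M ZK (-l' + toQ l) ≤ chiQ M ZK (-l'))
    -- `D` : the dominance defect
    (D : (V → ℤ) → ℚ)
    (hD0 : ∀ W : V → ℤ,
      (∀ l : V → ℤ, 0 < l → l ≤ W → chiQ M ZK (-l') < chiQ M ZK (-l' + toQ l)) →
      D W = 0)
    (hD1 : ∀ W : V → ℤ,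
      (∃ l : V → ℤ, 0 < l ∧ l ≤ W ∧ chiQ M ZK (-l' + toQ l) ≤ chiQ M ZK (-l')) →
      D W = 1)
    -- `μ W = min_{0 ≤ l ≤ W} χ(−l' + l)`
    (μ : (V → ℤ) → ℚ)
    (hμ : ∀ W : V → ℤ, 0 ≤ W →
      IsLeast {q : ℚ | ∃ l : V → ℤ, 0 ≤ l ∧ l ≤ W ∧
        q = chiQ M ZK (-l' + toQ l)} (μ W))
    -- `t = t(Z,l') = max_{0<Z''≤Z} Σ_i T(Z''_i,l')`, `T(W,l') = χ(−l') − μ W + D W`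
    (t : ℚ)
    (ht : IsGreatest {q : ℚ | ∃ W : V → ℤ, 0 < W ∧ W ≤ Z ∧
      q = sumComp M (fun W' => chiQ M ZK (-l') - μ W' + D W') W} t)
    -- `Z'` is a `≤`-minimal realizing cycle
    (Z' : V → ℤ) (hZ'pos : 0 < Z') (hZ'le : Z' ≤ Z)
    (hZ'max : sumComp M (fun W' => chiQ M ZK (-l') - μ W' + D W') Z' = t)
    (hZ'min : ∀ W : V → ℤ, 0 < W → W ≤ Z →
      sumComp M (fun W' => chiQ M ZK (-l') - μ W' + D W') W = t → W ≤ Z' → W = Z') :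
    ∀ c : (inducedOnSupp M Z').ConnectedComponent, D (compCycle M Z' c) = 1 := by
  intro c
  by_contra hDc
  have hZ'0 : 0 ≤ Z' := hZ'pos.le
  have hlt : ∀ l : V → ℤ, 0 < l → l ≤ compCycle M Z' c →
      chiQ M ZK (-l') < chiQ M ZK (-l' + toQ l) := by
    intro l h0 hl
    by_contra! h
    exact hDc (hD1 _ ⟨l, h0, hl, h⟩)
  have htoQ : toQ (0 : V → ℤ) = 0 := by
    funext v
    simp [toQ]
  have hμ_le (W : V → ℤ) (hW : 0 ≤ W) : μ W ≤ chiQ M ZK (-l') :=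
    (hμ W hW).2 ⟨0, le_rfl, hW, by rw [htoQ, add_zero]⟩
  have hμc : μ (compCycle M Z' c) = chiQ M ZK (-l') := by
    have hc := compCycle_nonneg M hZ'0 c
    refine le_antisymm (hμ_le _ hc) ?_
    obtain ⟨l, h0, hl, h⟩ := (hμ _ hc).1
    rw [h]
    rcases h0.eq_or_lt with rfl | h0
    · rw [htoQ, add_zero]
    · exact (hlt l h0 hl).le
  have hsum := sumComp_removeComp (fun W' => chiQ M ZK (-l') - μ W' + D W')
    (c := c) (by simp [hμc, hD0 _ hlt])
  have hle : removeComp M Z' c ≤ Z' := sub_le_self _ (compCycle_nonneg M hZ'0 c)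
  have hnonneg : 0 ≤ removeComp M Z' c := sub_nonneg.2 (compCycle_le M hZ'0 c)
  rcases hnonneg.eq_or_lt with h0 | hpos
  · rw [← h0, sumComp_zero, hZ'max] at hsum
    have hZpos : 0 < Z := hZ'pos.trans_le hZ'le
    have hT := ht.2 ⟨Z, hZpos, le_rfl, rfl⟩
    rw [sumComp_of_connected _ hconn fun v => by have := hZ v; omega, hD1 Z hnotdom] at hT
    have := hμ_le Z hZpos.le
    linarith
  · have h := hZ'min _ hpos (hle.trans hZ'le) (hsum.trans hZ'max) hle
    exact compCycle_ne_zero M Z' c (sub_eq_self.1 h)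
end

section
/- Let V be a nonempty finite set and let (·,·) be a negative definite symmetric ℤ-valued bilinear form on L := ℤ^V with standard basis {E_v}_{v∈V}, satisfying (E_u,E_v) ≥ 0 for u ≠ v; let Z_K ∈ ℚ^V be the unique vector with (Z_K,E_v) = (E_v,E_v)+2 for all v, and χ(x) := −(x, x−Z_K)/2. Fix l' with (l',E_v) a nonnegative integer for every v, and a cycle Z ∈ L with all coordinates ≥ 1. Then max_{0≤Z₁≤Z} ( −(l',Z₁) − min_{E_{|Z₁|} ≤ l ≤ Z₁} χ(l) + χ(E_{|Z₁|}) ) = max_{0≤Z₁≤Z} ( −(l',Z₁) − χ(Z₁) + χ(E_{|Z₁|}) ), where E_{|Z₁|} := Σ_{v∈|Z₁|} E_v, the inner minimum ranges over integral cycles l with E_{|Z₁|} ≤ l ≤ Z₁, and the term for Z₁ = 0 equals 0 in both maxima. -/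
open Classical

theorem pairQ_eq_sum_mul_single {V : Type} [Fintype V] [DecidableEq V] (M : Matrix V V ℤ)
    (x y : V → ℚ) : pairQ M x y = ∑ v, pairQ M x (Pi.single v 1) * y v := by
  have h : ∀ v, pairQ M x (Pi.single v 1) = ∑ u, x u * (M u v : ℚ) := by
    intro v
    simp [pairQ, Pi.single_apply]
  simp only [h, Finset.sum_mul]
  exact Finset.sum_comm

theorem pairQ_toQ_mono {V : Type} [Fintype V] [DecidableEq V] (M : Matrix V V ℤ)
    {x : V → ℚ} (hx : ∀ v, 0 ≤ pairQ M x (Pi.single v 1)) {a b : V → ℤ} (hab : a ≤ b) :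
    pairQ M x (toQ a) ≤ pairQ M x (toQ b) := by
  rw [pairQ_eq_sum_mul_single M x (toQ a), pairQ_eq_sum_mul_single M x (toQ b)]
  refine Finset.sum_le_sum fun v _ => mul_le_mul_of_nonneg_left ?_ (hx v)
  exact Int.cast_le.mpr (hab v)

/-- Proposition 5.3, combinatorial identity.
`max_{0≤Z₁≤Z} ( −(l',Z₁) − min_{E_{|Z₁|}≤l≤Z₁} χ(l) + χ(E_{|Z₁|}) )
 = max_{0≤Z₁≤Z} ( −(l',Z₁) − χ(Z₁) + χ(E_{|Z₁|}) )`,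
both maxima existing and equal; the term for `Z₁ = 0` is `0` in both. -/
theorem stmt_9
    (V : Type) [Fintype V] [DecidableEq V] [Nonempty V]
    (M : Matrix V V ℤ)
    (hsym : ∀ u v, M u v = M v u)
    (hneg : ∀ x : V → ℚ, x ≠ 0 → pairQ M x x < 0)
    (hoff : ∀ u v : V, u ≠ v → 0 ≤ M u v)
    (ZK : V → ℚ)
    (hZK : ∀ v, pairQ M ZK (Pi.single v 1) = (M v v : ℚ) + 2)
    (l' : V → ℚ)
    (hl' : ∀ v, ∃ n : ℕ, pairQ M l' (Pi.single v 1) = n)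
    (Z : V → ℤ) (hZ : ∀ v, 1 ≤ Z v)
    -- `ν Z₁ = min_{E_{|Z₁|} ≤ l ≤ Z₁} χ(l)`
    (ν : (V → ℤ) → ℚ)
    (hν : ∀ Z₁ : V → ℤ, 0 ≤ Z₁ →
      IsLeast {q : ℚ | ∃ l : V → ℤ,
          (fun v => if Z₁ v = 0 then 0 else (1 : ℤ)) ≤ l ∧ l ≤ Z₁ ∧
          q = chiQ M ZK (toQ l)} (ν Z₁)) :
    ∃ t : ℚ,
      IsGreatest {q : ℚ | ∃ Z₁ : V → ℤ, 0 ≤ Z₁ ∧ Z₁ ≤ Z ∧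
          q = -(pairQ M l' (toQ Z₁)) - ν Z₁ +
              chiQ M ZK (toQ (fun v => if Z₁ v = 0 then 0 else 1))} t ∧
      IsGreatest {q : ℚ | ∃ Z₁ : V → ℤ, 0 ≤ Z₁ ∧ Z₁ ≤ Z ∧
          q = -(pairQ M l' (toQ Z₁)) - chiQ M ZK (toQ Z₁) +
              chiQ M ZK (toQ (fun v => if Z₁ v = 0 then 0 else 1))} t := by
  have hx : ∀ v, 0 ≤ pairQ M l' (Pi.single v 1) := by
    intro v
    obtain ⟨n, hn⟩ := hl' v
    rw [hn]
    exact n.cast_nonneg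
  obtain ⟨Y, ⟨hY0, hYZ⟩, hmax⟩ := Set.exists_max_image (Set.Icc 0 Z)
    (fun Z₁ : V → ℤ => -(pairQ M l' (toQ Z₁)) - chiQ M ZK (toQ Z₁) +
      chiQ M ZK (toQ (fun v => if Z₁ v = 0 then 0 else 1)))
    (Set.finite_Icc 0 Z) ⟨0, le_rfl, fun v => zero_le_one.trans (hZ v)⟩
  have hle : ∀ Z₁ : V → ℤ, 0 ≤ Z₁ → Z₁ ≤ Z →
      -(pairQ M l' (toQ Z₁)) - ν Z₁ +
          chiQ M ZK (toQ (fun v => if Z₁ v = 0 then 0 else 1)) ≤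
        -(pairQ M l' (toQ Y)) - chiQ M ZK (toQ Y) +
          chiQ M ZK (toQ (fun v => if Y v = 0 then 0 else 1)) := by
    intro Z₁ h0 h1
    obtain ⟨l, hEl, hlZ, hl⟩ := (hν Z₁ h0).1
    have hl0 : 0 ≤ l := by
      intro v
      refine le_trans ?_ (hEl v)
      dsimp only [Pi.zero_apply]
      split_ifs <;> norm_num
    have hsupp : (fun v => if l v = 0 then (0 : ℤ) else 1) =
        fun v => if Z₁ v = 0 then 0 else 1 := by
      funext v
      have h2 := hEl v
      have h3 := hlZ v
      have h4 := hl0 v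
      dsimp only [Pi.zero_apply] at h2 h4
      by_cases hz : Z₁ v = 0
      · have hl : l v = 0 := le_antisymm (hz ▸ h3) h4
        rw [if_pos hz, if_pos hl]
      · rw [if_neg hz] at h2
        rw [if_neg hz, if_neg (by omega)]
    have hlY := hmax l ⟨hl0, hlZ.trans h1⟩
    have hmono := pairQ_toQ_mono M hx hlZ
    rw [hsupp] at hlY
    rw [hl]
    linarith
  refine ⟨_, ⟨⟨Y, hY0, hYZ, le_antisymm ?_ (hle Y hY0 hYZ)⟩, ?_⟩, ⟨Y, hY0, hYZ, rfl⟩, ?_⟩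
  · have hνY : ν Y ≤ chiQ M ZK (toQ Y) := by
      refine (hν Y hY0).2 ⟨Y, fun v => ?_, le_rfl, rfl⟩
      have h0 := hY0 v
      dsimp only [Pi.zero_apply] at h0 ⊢
      split_ifs <;> omega
    linarith
  · rintro q ⟨Z₁, h0, h1, rfl⟩
    exact hle Z₁ h0 h1
  · rintro q ⟨Z₁, h0, h1, rfl⟩
    exact hmax Z₁ ⟨h0, h1⟩
end
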